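/- There exist constants C>0 and h_0>0, depending only on k, α, β, γ, b-a and the quasi-uniformity constant c, such that whenever h ≤ h_0, u is 2k-times continuously differentiable with u(a)=u(b)=0, f := -αu''+βu'+γu, ū_h is a Gauss collocation solution and u_I is the truncated Jacobi projection of u, then ‖ū_h-u_I‖_2 ≤ C h^{k} ‖u‖_{2k,∞}. -/

import Mathlib

open Set Finset intervalIntegral

/-- The Legendre polynomial of degree `n` (Rodrigues formula), as a real function. -/
noncomputable def legendre (n : ℕ) : ℝ → ℝ :=
  fun s => (1 / ((2 : ℝ) ^ n * n.factorial)) * iteratedDeriv n (fun t : ℝ => (t ^ 2 - 1) ^ n) s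

/-- The affine map sending `[-1,1]` onto `[p,q]`. -/
noncomputable def affMap (p q s : ℝ) : ℝ := (p + q) / 2 + s * (q - p) / 2

/-- `x 0 = a < x 1 < ... < x N = b` is a partition of `[a,b]`. -/
def IsMesh (a b : ℝ) (N : ℕ) (x : ℕ → ℝ) : Prop :=
  1 ≤ N ∧ x 0 = a ∧ x N = b ∧ ∀ i < N, x i < x (i + 1)

/-- `h` is the maximal element length `h = max_i (x i - x (i-1))`. -/
def IsMeshSize (N : ℕ) (x : ℕ → ℝ) (h : ℝ) : Prop :=
  (∀ i ∈ Finset.Icc 1 N, x i - x (i - 1) ≤ h) ∧ ∃ i ∈ Finset.Icc 1 N, x i - x (i - 1) = h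

/-- Quasi-uniformity with constant `c`: `h ≤ c · h_i` for all elements. -/
def IsQuasiUniform (N : ℕ) (x : ℕ → ℝ) (h c : ℝ) : Prop :=
  ∀ i ∈ Finset.Icc 1 N, h ≤ c * (x i - x (i - 1))

/-- `P i` are the element polynomials (degree ≤ k) of a member of `V_h^0`:
a C¹ piecewise polynomial vanishing at both ends of `[a,b]`. -/
def IsVh0 (k N : ℕ) (x : ℕ → ℝ) (P : ℕ → Polynomial ℝ) : Prop :=
  (∀ i ∈ Finset.Icc 1 N, (P i).natDegree ≤ k) ∧
  (∀ i ∈ Finset.Icc 1 (N - 1), (P i).eval (x i) = (P (i + 1)).eval (x i)) ∧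
  (∀ i ∈ Finset.Icc 1 (N - 1),
      (Polynomial.derivative (P i)).eval (x i) = (Polynomial.derivative (P (i + 1))).eval (x i)) ∧
  (P 1).eval (x 0) = 0 ∧ (P N).eval (x N) = 0

/-- `P i` are the element polynomials of a Petrov–Galerkin solution `u_h ∈ V_h^0`:
`∑_i ∫_{τ_i} (-α u_h'' + β u_h' + γ u_h) v_h = ∫_a^b f v_h` for all `v_h ∈ W_h`. -/
def IsPGSol (k N : ℕ) (x : ℕ → ℝ) (α β γ : ℝ) (f : ℝ → ℝ) (P : ℕ → Polynomial ℝ) : Prop :=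
  IsVh0 k N x P ∧
  ∀ Q : ℕ → Polynomial ℝ, (∀ i ∈ Finset.Icc 1 N, (Q i).natDegree ≤ k - 2) →
    (∑ i ∈ Finset.Icc 1 N, ∫ t in (x (i - 1))..(x i),
        (-α * ((Polynomial.derivative (Polynomial.derivative (P i))).eval t)
            + β * ((Polynomial.derivative (P i)).eval t) + γ * (P i).eval t) * (Q i).eval t)
      = ∑ i ∈ Finset.Icc 1 N, ∫ t in (x (i - 1))..(x i), f t * (Q i).eval t

/-- `P i` are the element polynomials of a Gauss collocation solution `ū_h ∈ V_h^0`: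
`(-α ū_h'' + β ū_h' + γ ū_h)(g) = f(g)` at every Gauss point `g` of every element. -/
def IsGaussSol (k N : ℕ) (x : ℕ → ℝ) (α β γ : ℝ) (f : ℝ → ℝ) (P : ℕ → Polynomial ℝ) : Prop :=
  IsVh0 k N x P ∧
  ∀ i ∈ Finset.Icc 1 N, ∀ s ∈ Set.Ioo (-1 : ℝ) 1, legendre (k - 1) s = 0 →
    -α * ((Polynomial.derivative (Polynomial.derivative (P i))).eval (affMap (x (i - 1)) (x i) s))
        + β * ((Polynomial.derivative (P i)).eval (affMap (x (i - 1)) (x i) s))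
        + γ * (P i).eval (affMap (x (i - 1)) (x i) s)
      = f (affMap (x (i - 1)) (x i) s)

/-- `p` is the elementwise truncated Jacobi projection of `u` on the element `[xl, xr]`:
the polynomial of degree ≤ k matching `u` and `u'` at both endpoints with
`(u - p)'' ⊥ P_{k-2}` in `L²(xl, xr)`. -/
def IsElemProj (k : ℕ) (u : ℝ → ℝ) (xl xr : ℝ) (p : Polynomial ℝ) : Prop :=
  p.natDegree ≤ k ∧ p.eval xl = u xl ∧ p.eval xr = u xr ∧
  (Polynomial.derivative p).eval xl = deriv u xl ∧
  (Polynomial.derivative p).eval xr = deriv u xr ∧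
  ∀ q : Polynomial ℝ, q.natDegree ≤ k - 2 →
    (∫ t in xl..xr,
        (iteratedDeriv 2 u t - (Polynomial.derivative (Polynomial.derivative p)).eval t)
          * q.eval t) = 0

open Polynomial in
/-- The unnormalised Legendre polynomial `(d/dX)^n (X^2-1)^n`. -/
noncomputable def rodrigues (n : ℕ) : ℝ[X] := derivative^[n] ((X ^ 2 - 1) ^ n)

open Polynomial in
theorem iteratedDeriv_eval_polynomial (n : ℕ) (p : ℝ[X]) :
    iteratedDeriv n (fun t : ℝ => p.eval t) = fun t => (derivative^[n] p).eval t := by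
  induction n generalizing p with
  | zero => simp
  | succ n ih =>
    rw [iteratedDeriv_succ', Function.iterate_succ_apply, ← ih]
    congr 1
    ext t
    simp

open Polynomial in
theorem legendre_eq_zero_iff (n : ℕ) (s : ℝ) : legendre n s = 0 ↔ (rodrigues n).eval s = 0 := by
  have h : (fun t : ℝ => (t ^ 2 - 1) ^ n) = fun t => ((X ^ 2 - 1 : ℝ[X]) ^ n).eval t := by
    ext t; simp
  unfold legendre
  rw [h, iteratedDeriv_eval_polynomial]
  have h2 : (1 / ((2 : ℝ) ^ n * n.factorial)) ≠ 0 := by positivity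
  simp only [mul_eq_zero, h2, false_or, rodrigues]

open Polynomial in
theorem natDegree_X_sq_sub_one_pow (n : ℕ) : ((X ^ 2 - 1 : ℝ[X]) ^ n).natDegree = 2 * n := by
  have : (X ^ 2 - 1 : ℝ[X]).natDegree = 2 := by
    rw [← C_1, natDegree_X_pow_sub_C]
  rw [natDegree_pow, this, mul_comm]

open Polynomial in
theorem rodrigues_coeff_ne_zero (n : ℕ) : (rodrigues n).coeff n ≠ 0 := by
  have hm : ((X ^ 2 - 1 : ℝ[X]) ^ n).Monic := by
    rw [← C_1]
    exact (monic_X_pow_sub_C _ (by norm_num)).pow n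
  have h2 : ((X ^ 2 - 1 : ℝ[X]) ^ n).coeff (n + n) = 1 := by
    rw [← two_mul, ← natDegree_X_sq_sub_one_pow n]; exact hm
  rw [rodrigues, coeff_iterate_derivative, h2]
  simp only [nsmul_eq_mul, mul_one, ne_eq, Nat.cast_eq_zero, Nat.descFactorial_eq_zero_iff_lt]
  omega

open Polynomial in
theorem natDegree_rodrigues_le (n : ℕ) : (rodrigues n).natDegree ≤ n := by
  have := natDegree_iterate_derivative ((X ^ 2 - 1 : ℝ[X]) ^ n) n
  rw [natDegree_X_sq_sub_one_pow] at this
  unfold rodrigues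
  omega

open Polynomial in
theorem eval_iterate_derivative_X_sq_sub_one_pow {n j : ℕ} (hj : j < n) {s : ℝ} (hs : s ^ 2 = 1) :
    (derivative^[j] ((X ^ 2 - 1 : ℝ[X]) ^ n)).eval s = 0 := by
  obtain ⟨q, hq⟩ := pow_sub_dvd_iterate_derivative_pow (X ^ 2 - 1 : ℝ[X]) n j
  rw [hq]
  simp [hs, show n - j ≠ 0 by omega]

open Polynomial in
theorem integral_derivative_mul (p q : ℝ[X]) (a b : ℝ) :
    ∫ t in a..b, (derivative p).eval t * q.eval t
      = p.eval b * q.eval b - p.eval a * q.eval a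
        - ∫ t in a..b, p.eval t * (derivative q).eval t := by
  rw [intervalIntegral.integral_mul_deriv_eq_deriv_mul (u := fun t => p.eval t)
    (fun t _ => p.hasDerivAt t) (fun t _ => q.hasDerivAt t)
    ((derivative p).continuous.intervalIntegrable _ _)
    ((derivative q).continuous.intervalIntegrable _ _)]
  ring

open Polynomial in
theorem integral_iterate_derivative_mul (n : ℕ) (q : ℝ[X]) {j : ℕ} (hj : j ≤ n) :
    ∫ t in (-1 : ℝ)..1, (derivative^[j] ((X ^ 2 - 1 : ℝ[X]) ^ n)).eval t * q.eval t
      = (-1) ^ j * ∫ t in (-1 : ℝ)..1, ((X ^ 2 - 1 : ℝ[X]) ^ n).eval t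
          * (derivative^[j] q).eval t := by
  induction j generalizing q with
  | zero => simp
  | succ j ih =>
    rw [Function.iterate_succ_apply', integral_derivative_mul,
      eval_iterate_derivative_X_sq_sub_one_pow (by omega) (by norm_num),
      eval_iterate_derivative_X_sq_sub_one_pow (by omega) (by norm_num), ih _ (by omega),
      Function.iterate_succ_apply]
    ring

open Polynomial in
theorem integral_rodrigues_mul {n : ℕ} {q : ℝ[X]} (hq : q.natDegree < n) :
    ∫ t in (-1 : ℝ)..1, (rodrigues n).eval t * q.eval t = 0 := by
  rw [rodrigues, integral_iterate_derivative_mul n q le_rfl, iterate_derivative_eq_zero hq]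
  simp

open Polynomial in
theorem exists_roots_iterate_derivative (n : ℕ) {j : ℕ} (hj : j ≤ n) :
    ∃ z : Fin j → ℝ, StrictMono z ∧ ∀ i, z i ∈ Set.Ioo (-1 : ℝ) 1 ∧
      (derivative^[j] ((X ^ 2 - 1 : ℝ[X]) ^ n)).eval (z i) = 0 := by
  induction j with
  | zero => exact ⟨Fin.elim0, fun i => i.elim0, fun i => i.elim0⟩
  | succ j ih =>
    obtain ⟨z, hz, hz'⟩ := ih (by omega)
    set p := derivative^[j] ((X ^ 2 - 1 : ℝ[X]) ^ n) with hp
    let y : ℕ → ℝ := fun i => if i = 0 then -1 else if h : i - 1 < j then z ⟨i - 1, h⟩ else 1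
    have hy0 : ∀ i, p.eval (y i) = 0 := by
      intro i
      simp only [y]
      split_ifs with h1 h2
      · exact eval_iterate_derivative_X_sq_sub_one_pow (by omega) (by norm_num)
      · exact (hz' _).2
      · exact eval_iterate_derivative_X_sq_sub_one_pow (by omega) (by norm_num)
    have hyI : ∀ i, y i ∈ Set.Icc (-1 : ℝ) 1 := by
      intro i
      simp only [y]
      split_ifs with h1 h2
      · norm_num
      · exact Set.Ioo_subset_Icc_self (hz' _).1
      · norm_num
    have hy1 : ∀ i < j + 1, y i < y (i + 1) := by
      intro i hi
      rcases Nat.eq_zero_or_pos i with rfl | h1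
      · by_cases h2 : 0 < j
        · simpa [y, h2] using (hz' ⟨0, h2⟩).1.1
        · simp [y, h2]
      · have h3 : i - 1 < j := by omega
        by_cases h2 : i < j
        · have : z ⟨i - 1, h3⟩ < z ⟨i, h2⟩ := hz (by simp only [Fin.mk_lt_mk]; omega)
          simpa [y, h1.ne', h3, h2] using this
        · simpa [y, h1.ne', h3, h2] using (hz' ⟨i - 1, h3⟩).1.2
    have hr : ∀ i : Fin (j + 1), ∃ w ∈ Set.Ioo (y i) (y (i + 1)), (derivative p).eval w = 0 :=
      fun i => exists_hasDerivAt_eq_zero (hy1 i i.2) p.continuous.continuousOn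
        (by rw [hy0, hy0]) (fun t _ => p.hasDerivAt t)
    choose w hw hw0 using hr
    refine ⟨w, Fin.strictMono_iff_lt_succ.2 fun i => ?_, fun i => ⟨⟨?_, ?_⟩, ?_⟩⟩
    · exact (hw i.castSucc).2.trans (by simpa using (hw i.succ).1)
    · exact (hyI _).1.trans_lt (hw i).1
    · exact (hw i).2.trans_le (hyI _).2
    · rw [Function.iterate_succ_apply']; exact hw0 i

/-- The Gauss points in `(-1,1)`: there are `n` distinct roots of the Legendre polynomial. -/
theorem exists_gauss_points (n : ℕ) :
    ∃ z : Fin n → ℝ, Function.Injective z ∧ ∀ i, z i ∈ Set.Ioo (-1 : ℝ) 1 ∧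
      legendre n (z i) = 0 := by
  obtain ⟨z, hz, h⟩ := exists_roots_iterate_derivative n le_rfl
  exact ⟨z, hz.injective, fun i => ⟨(h i).1, (legendre_eq_zero_iff n _).2 (h i).2⟩⟩

open Polynomial in
theorem exists_bound_of_injective {ι : Type*} [Fintype ι] (n : ℕ) (A : ℝ[X] →ₗ[ℝ] (ι → ℝ))
    (hA : ∀ q : ℝ[X], q.degree < n → A q = 0 → q = 0) :
    ∃ K > 0, ∀ q : ℝ[X], q.degree < n → ∀ δ : ℝ, 0 ≤ δ → (∀ j, |A q j| ≤ δ) →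
      ∀ s ∈ Set.Icc (-1 : ℝ) 1, |q.eval s| ≤ K * δ := by
  let L : (Fin n → ℝ) →ₗ[ℝ] (ι → ℝ) :=
    A ∘ₗ (degreeLT ℝ n).subtype ∘ₗ (degreeLTEquiv ℝ n).symm.toLinearMap
  have hL : LinearMap.ker L = ⊥ := by
    refine LinearMap.ker_eq_bot'.2 fun c hc => ?_
    have h1 : ((degreeLTEquiv ℝ n).symm c : ℝ[X]) = 0 :=
      hA _ (mem_degreeLT.1 ((degreeLTEquiv ℝ n).symm c).2) hc
    have h2 : (degreeLTEquiv ℝ n).symm c = 0 := Subtype.ext h1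
    simpa using h2
  obtain ⟨K, hK, hKL⟩ := L.exists_antilipschitzWith hL
  refine ⟨(n + 1) * K, by positivity, fun q hq δ hδ h s hs => ?_⟩
  set c := degreeLTEquiv ℝ n ⟨q, mem_degreeLT.2 hq⟩ with hc
  have h1 : L c = A q := by simp [L, hc]
  have h2 : ‖c‖ ≤ K * δ := by
    have h3 := hKL.le_mul_dist c 0
    rw [map_zero, dist_zero_right, dist_zero_right, h1] at h3
    exact h3.trans (mul_le_mul_of_nonneg_left ((pi_norm_le_iff_of_nonneg hδ).2 h) K.2)
  have h4 : q.eval s = ∑ i, c i * s ^ (i : ℕ) := by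
    rw [eval_eq_sum_degreeLTEquiv (mem_degreeLT.2 hq)]
  have hs' : |s| ≤ 1 := abs_le.2 hs
  rw [h4]
  calc |∑ i, c i * s ^ (i : ℕ)| ≤ ∑ i, |c i * s ^ (i : ℕ)| := Finset.abs_sum_le_sum_abs _ _
    _ ≤ ∑ _i : Fin n, K * δ := by
        refine Finset.sum_le_sum fun i _ => ?_
        rw [abs_mul, abs_pow]
        calc |c i| * |s| ^ (i : ℕ) ≤ |c i| * 1 := by
              gcongr; exact pow_le_one₀ (abs_nonneg _) hs'
          _ ≤ K * δ := by rw [mul_one]; exact (norm_le_pi_norm c i).trans h2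
    _ = n * (K * δ) := by simp
    _ ≤ (n + 1) * K * δ := by
        have : 0 ≤ (K : ℝ) * δ := by positivity
        nlinarith

open Polynomial in
/-- Sup-norm stability of interpolation at the Gauss points. -/
theorem exists_bound_of_gauss_points (n : ℕ) :
    ∃ K > 0, ∀ q : ℝ[X], q.degree < n → ∀ δ : ℝ, 0 ≤ δ →
      (∀ s ∈ Set.Ioo (-1 : ℝ) 1, legendre n s = 0 → |q.eval s| ≤ δ) →
      ∀ s ∈ Set.Icc (-1 : ℝ) 1, |q.eval s| ≤ K * δ := by
  obtain ⟨z, hz, hz'⟩ := exists_gauss_points n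
  obtain ⟨K, hK, h⟩ := exists_bound_of_injective n (LinearMap.pi fun i => leval (z i)) (by
    intro q hq h0
    exact eq_zero_of_degree_lt_of_eval_index_eq_zero Finset.univ hz.injOn
      (by simpa using hq) fun i _ => congrFun h0 i)
  exact ⟨K, hK, fun q hq δ hδ hδ' => h q hq δ hδ fun i => hδ' _ (hz' i).1 (hz' i).2⟩

open Polynomial in
theorem eq_zero_of_moments {n : ℕ} {q : ℝ[X]} (hq : q.degree < n)
    (h : ∀ j < n, ∫ t in (-1 : ℝ)..1, q.eval t * t ^ j = 0) : q = 0 := by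
  have h1 : ∫ t in (-1 : ℝ)..1, q.eval t ^ 2 = 0 := by
    have : ∀ t, q.eval t ^ 2 = ∑ j ∈ Finset.range n, q.coeff j * (q.eval t * t ^ j) := by
      intro t
      have h2 : q.eval t = ∑ j ∈ Finset.range n, q.coeff j * t ^ j := by
        by_cases hn : q = 0
        · simp [hn]
        · exact eval_eq_sum_range' ((natDegree_lt_iff_degree_lt hn).2 hq) t
      rw [sq]
      nth_rw 2 [h2]
      rw [Finset.mul_sum]
      exact Finset.sum_congr rfl fun j _ => by ring
    simp_rw [this]
    rw [intervalIntegral.integral_finsetSum fun j _ =>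
      (by fun_prop : Continuous fun t => q.coeff j * (q.eval t * t ^ j)).intervalIntegrable _ _]
    refine Finset.sum_eq_zero fun j hj => ?_
    rw [intervalIntegral.integral_const_mul, h j (Finset.mem_range.1 hj), mul_zero]
  by_contra hne
  have hinf : ¬ (Set.Icc (-1 : ℝ) 1 ⊆ {x | IsRoot q x}) := fun hsub =>
    hne (eq_zero_of_infinite_isRoot q ((Set.Icc_infinite (by norm_num)).mono hsub))
  obtain ⟨t, ht, ht'⟩ := Set.not_subset.1 hinf
  have := intervalIntegral.integral_pos (a := (-1 : ℝ)) (b := 1) (f := fun t => q.eval t ^ 2)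
    (by norm_num) (by fun_prop) (fun t _ => sq_nonneg _)
    ⟨t, ht, by have : q.eval t ≠ 0 := ht'; positivity⟩
  linarith

open Polynomial in
theorem exists_bound_of_moments (n : ℕ) :
    ∃ K > 0, ∀ q : ℝ[X], q.degree < n → ∀ δ : ℝ, 0 ≤ δ →
      (∀ j < n, |∫ t in (-1 : ℝ)..1, q.eval t * t ^ j| ≤ δ) →
      ∀ s ∈ Set.Icc (-1 : ℝ) 1, |q.eval s| ≤ K * δ := by
  let A : ℝ[X] →ₗ[ℝ] (Fin n → ℝ) :=
    { toFun := fun q j => ∫ t in (-1 : ℝ)..1, q.eval t * t ^ (j : ℕ)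
      map_add' := fun p q => by
        ext j
        simp only [eval_add, add_mul, Pi.add_apply]
        exact intervalIntegral.integral_add
          ((by fun_prop : Continuous fun t => p.eval t * t ^ (j : ℕ)).intervalIntegrable _ _)
          ((by fun_prop : Continuous fun t => q.eval t * t ^ (j : ℕ)).intervalIntegrable _ _)
      map_smul' := fun r q => by
        ext j
        simp [mul_assoc] }
  obtain ⟨K, hK, h⟩ := exists_bound_of_injective n A fun q hq h0 =>
    eq_zero_of_moments hq fun j hj => congrFun h0 ⟨j, hj⟩
  exact ⟨K, hK, fun q hq δ hδ hδ' => h q hq δ hδ fun i => hδ' _ i.2⟩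

open Polynomial in
/-- Sup-norm quasi-optimality of the `L²` projection onto polynomials of degree `< n`. -/
theorem exists_bound_projection (n : ℕ) :
    ∃ K > 0, ∀ (w : ℝ → ℝ) (ρ : ℝ[X]) (δ : ℝ), Continuous w → ρ.degree < n → 0 ≤ δ →
      (∀ j < n, ∫ t in (-1 : ℝ)..1, (w t - ρ.eval t) * t ^ j = 0) →
      (∀ s ∈ Set.Icc (-1 : ℝ) 1, |w s| ≤ δ) → ∀ s ∈ Set.Icc (-1 : ℝ) 1, |ρ.eval s| ≤ K * δ := by
  obtain ⟨K, hK, h⟩ := exists_bound_of_moments n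
  refine ⟨K * 2, by positivity, fun w ρ δ hw hρ hδ h0 hwδ s hs => ?_⟩
  rw [mul_assoc]
  refine h ρ hρ (2 * δ) (by positivity) (fun j hj => ?_) s hs
  have h1 := h0 j hj
  simp only [sub_mul] at h1
  rw [intervalIntegral.integral_sub
    ((by fun_prop : Continuous fun t => w t * t ^ j).intervalIntegrable _ _)
    ((by fun_prop : Continuous fun t => ρ.eval t * t ^ j).intervalIntegrable _ _), sub_eq_zero] at h1
  rw [← h1]
  have h2 := intervalIntegral.norm_integral_le_of_norm_le_const (a := (-1 : ℝ)) (b := 1)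
    (f := fun t => w t * t ^ j) (C := δ) (by
      intro t ht
      rw [Set.uIoc_of_le (by norm_num)] at ht
      have ht' : |t| ≤ 1 := abs_le.2 ⟨ht.1.le, ht.2⟩
      rw [Real.norm_eq_abs, abs_mul, abs_pow]
      calc |w t| * |t| ^ j ≤ δ * 1 := by
            gcongr
            · exact hwδ t ⟨ht.1.le, ht.2⟩
            · exact pow_le_one₀ (abs_nonneg _) ht'
        _ = δ := mul_one _)
  rw [Real.norm_eq_abs] at h2
  norm_num at h2
  linarith

open Polynomial in
/-- The error of the `L²` projection, on `[-1,1]` and, with one order more, at the Gauss points. -/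
theorem exists_bound_projection_error (n : ℕ) :
    ∃ K > 0, ∀ (w : ℝ → ℝ) (π : ℝ[X]), Continuous w → π.degree < n →
      (∀ j < n, ∫ t in (-1 : ℝ)..1, (w t - π.eval t) * t ^ j = 0) →
      (∀ (T : ℝ[X]) (δ : ℝ), T.degree < n → 0 ≤ δ →
        (∀ s ∈ Set.Icc (-1 : ℝ) 1, |w s - T.eval s| ≤ δ) →
        ∀ s ∈ Set.Icc (-1 : ℝ) 1, |w s - π.eval s| ≤ K * δ) ∧
      (∀ (T : ℝ[X]) (δ : ℝ), T.natDegree ≤ n → 0 ≤ δ →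
        (∀ s ∈ Set.Icc (-1 : ℝ) 1, |w s - T.eval s| ≤ δ) →
        ∀ s ∈ Set.Icc (-1 : ℝ) 1, legendre n s = 0 → |w s - π.eval s| ≤ K * δ) := by
  obtain ⟨K, hK, h⟩ := exists_bound_projection n
  refine ⟨1 + K, by positivity, fun w π hw hπ h0 => ⟨fun T δ hT hδ hwT s hs => ?_,
    fun T δ hT hδ hwT s hs hls => ?_⟩⟩
  · have h1 := h (fun t => w t - T.eval t) (π - T) δ (by fun_prop)
      ((degree_sub_le _ _).trans_lt (max_lt hπ hT)) hδ (by
        intro j hj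
        rw [← h0 j hj]
        congr 1
        ext t
        rw [eval_sub]; ring) hwT s hs
    have h2 := hwT s hs
    rw [eval_sub] at h1
    rw [abs_le] at *
    constructor <;> nlinarith
  · set c := T.coeff n / (rodrigues n).coeff n with hc
    have hR : (T - C c * rodrigues n).degree < n := by
      rw [degree_lt_iff_coeff_zero]
      intro m hm
      rcases hm.eq_or_lt with rfl | hm
      · simp [hc, rodrigues_coeff_ne_zero]
      · rw [coeff_sub, coeff_C_mul, coeff_eq_zero_of_natDegree_lt (hT.trans_lt hm),
          coeff_eq_zero_of_natDegree_lt ((natDegree_rodrigues_le n).trans_lt hm)]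
        simp
    have h1 := h (fun t => w t - T.eval t) (π - (T - C c * rodrigues n)) δ (by fun_prop)
      ((degree_sub_le _ _).trans_lt (max_lt hπ hR)) hδ (by
        intro j hj
        have h3 : ∫ t in (-1 : ℝ)..1, (rodrigues n).eval t * t ^ j = 0 := by
          simpa using integral_rodrigues_mul (n := n) (q := X ^ j) (by simpa using hj)
        have h4 : ∀ t, (w t - T.eval t - (π - (T - C c * rodrigues n)).eval t) * t ^ j
            = (w t - π.eval t) * t ^ j - c * ((rodrigues n).eval t * t ^ j) := by
          intro t
          simp only [eval_sub, eval_mul, eval_C]; ring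
        simp_rw [h4]
        rw [intervalIntegral.integral_sub
          ((by fun_prop : Continuous fun t => (w t - π.eval t) * t ^ j).intervalIntegrable _ _)
          ((by fun_prop : Continuous fun t =>
            c * ((rodrigues n).eval t * t ^ j)).intervalIntegrable _ _), h0 j hj,
          intervalIntegral.integral_const_mul, h3]
        simp) hwT s hs
    have h2 := hwT s hs
    have h5 := (legendre_eq_zero_iff n s).1 hls
    simp only [eval_sub, eval_mul, eval_C, h5, mul_zero, sub_zero] at h1
    rw [abs_le] at *
    constructor <;> nlinarith

theorem affMap_mem_Icc {p q s : ℝ} (h : p < q) (hs : s ∈ Set.Icc (-1 : ℝ) 1) :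
    affMap p q s ∈ Set.Icc p q := by
  obtain ⟨h1, h2⟩ := hs
  unfold affMap
  constructor <;> nlinarith

theorem exists_affMap_eq {p q t : ℝ} (h : p < q) (ht : t ∈ Set.Icc p q) :
    ∃ s ∈ Set.Icc (-1 : ℝ) 1, affMap p q s = t := by
  obtain ⟨h1, h2⟩ := ht
  have h3 : 0 < q - p := sub_pos.2 h
  refine ⟨(2 * t - p - q) / (q - p), ⟨?_, ?_⟩, ?_⟩
  · rw [le_div_iff₀ h3]; linarith
  · rw [div_le_iff₀ h3]; linarith
  · unfold affMap; field_simp; ring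

open Polynomial in
theorem exists_affMap_polynomial {p q : ℝ} (h : p < q) :
    ∃ A B : ℝ[X], A.natDegree ≤ 1 ∧ B.natDegree ≤ 1 ∧ (∀ s, A.eval s = affMap p q s) ∧
      ∀ s, B.eval (affMap p q s) = s := by
  have h3 : q - p ≠ 0 := (sub_pos.2 h).ne'
  refine ⟨C ((q - p) / 2) * X + C ((p + q) / 2),
    C (2 / (q - p)) * X + C (-(p + q) / (q - p)), natDegree_linear_le, natDegree_linear_le,
    fun s => ?_, fun s => ?_⟩
  · simp [affMap]; ring
  · simp [affMap]; field_simp; ring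

open Polynomial in
theorem natDegree_comp_le_of_natDegree_le_one {p A : ℝ[X]} (hA : A.natDegree ≤ 1) :
    (p.comp A).natDegree ≤ p.natDegree := by
  have := natDegree_comp_le (p := p) (q := A)
  nlinarith

open Polynomial in
theorem degree_comp_lt_of_natDegree_le_one {p A : ℝ[X]} {n : ℕ} (hA : A.natDegree ≤ 1)
    (hp : p.degree < n) : (p.comp A).degree < n := by
  by_cases h0 : p = 0
  · simp [h0]
  · exact degree_le_natDegree.trans_lt (by
      exact_mod_cast (natDegree_comp_le_of_natDegree_le_one hA).trans_lt
        ((natDegree_lt_iff_degree_lt h0).2 hp))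

theorem integral_comp_affMap (F : ℝ → ℝ) (p q : ℝ) :
    (q - p) / 2 * ∫ s in (-1 : ℝ)..1, F (affMap p q s) = ∫ t in p..q, F t := by
  have h := intervalIntegral.smul_integral_comp_mul_add (a := -1) (b := 1) F ((q - p) / 2)
    ((p + q) / 2)
  have h1 : ∀ s, affMap p q s = (q - p) / 2 * s + (p + q) / 2 := fun s => by
    unfold affMap; ring
  simp_rw [h1]
  rw [← smul_eq_mul, h]
  congr 1 <;> ring

open Polynomial in
theorem exists_bound_of_element_gauss_points (n : ℕ) :
    ∃ K > 0, ∀ (q : ℝ[X]) (xl xr δ : ℝ), q.degree < n → xl < xr → 0 ≤ δ →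
      (∀ s ∈ Set.Ioo (-1 : ℝ) 1, legendre n s = 0 → |q.eval (affMap xl xr s)| ≤ δ) →
      ∀ t ∈ Set.Icc xl xr, |q.eval t| ≤ K * δ := by
  obtain ⟨K, hK, h⟩ := exists_bound_of_gauss_points n
  refine ⟨K, hK, fun q xl xr δ hq hx hδ hg t ht => ?_⟩
  obtain ⟨A, B, hA, -, hAe, -⟩ := exists_affMap_polynomial hx
  obtain ⟨s, hs, rfl⟩ := exists_affMap_eq hx ht
  have := h (q.comp A) (degree_comp_lt_of_natDegree_le_one hA hq) δ hδ (by
    simpa [eval_comp, hAe] using hg) s hs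
  simpa [eval_comp, hAe] using this

open Polynomial in
theorem exists_bound_element_projection_error (n : ℕ) :
    ∃ K > 0, ∀ (w : ℝ → ℝ) (π : ℝ[X]) (xl xr : ℝ), Continuous w → π.degree < n → xl < xr →
      (∀ q : ℝ[X], q.natDegree < n → ∫ t in xl..xr, (w t - π.eval t) * q.eval t = 0) →
      (∀ (T : ℝ[X]) (δ : ℝ), T.degree < n → 0 ≤ δ →
        (∀ t ∈ Set.Icc xl xr, |w t - T.eval t| ≤ δ) →
        ∀ t ∈ Set.Icc xl xr, |w t - π.eval t| ≤ K * δ) ∧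
      (∀ (T : ℝ[X]) (δ : ℝ), T.natDegree ≤ n → 0 ≤ δ →
        (∀ t ∈ Set.Icc xl xr, |w t - T.eval t| ≤ δ) →
        ∀ s ∈ Set.Icc (-1 : ℝ) 1, legendre n s = 0 →
          |w (affMap xl xr s) - π.eval (affMap xl xr s)| ≤ K * δ) := by
  obtain ⟨K, hK, h⟩ := exists_bound_projection_error n
  refine ⟨K, hK, fun w π xl xr hw hπ hx h0 => ?_⟩
  obtain ⟨A, B, hA, hB, hAe, hBe⟩ := exists_affMap_polynomial hx
  have hc : Continuous (affMap xl xr) := by unfold affMap; fun_prop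
  obtain ⟨h1, h2⟩ := h (w ∘ affMap xl xr) (π.comp A) (hw.comp hc)
    (degree_comp_lt_of_natDegree_le_one hA hπ) (by
      intro j hj
      have h3 := h0 (B ^ j) (natDegree_pow_le.trans_lt (by nlinarith))
      rw [← integral_comp_affMap] at h3
      have h4 : (xr - xl) / 2 ≠ 0 := by
        have := sub_pos.2 hx
        positivity
      simpa [h4, hBe, eval_comp, hAe] using h3)
  refine ⟨fun T δ hT hδ hwT t ht => ?_, fun T δ hT hδ hwT s hs hls => ?_⟩
  · obtain ⟨s, hs, rfl⟩ := exists_affMap_eq hx ht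
    simpa [eval_comp, hAe] using h1 (T.comp A) δ (degree_comp_lt_of_natDegree_le_one hA hT) hδ
      (fun s hs => by simpa [eval_comp, hAe] using hwT _ (affMap_mem_Icc hx hs)) s hs
  · simpa [eval_comp, hAe] using h2 (T.comp A) δ
      ((natDegree_comp_le_of_natDegree_le_one hA).trans hT) hδ
      (fun s hs => by simpa [eval_comp, hAe] using hwT _ (affMap_mem_Icc hx hs)) s hs hls

open Polynomial in
theorem exists_taylor_polynomial {v : ℝ → ℝ} {n : ℕ} (hv : ContDiff ℝ (n + 1) v) {xl xr M : ℝ}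
    (hx : xl < xr) (hM : ∀ y ∈ Set.Icc xl xr, |iteratedDeriv (n + 1) v y| ≤ M) :
    ∃ T : ℝ[X], T.natDegree ≤ n ∧
      ∀ t ∈ Set.Icc xl xr, |v t - T.eval t| ≤ M * (xr - xl) ^ (n + 1) := by
  have hM0 : 0 ≤ M := (abs_nonneg _).trans (hM xl ⟨le_rfl, hx.le⟩)
  refine ⟨∑ j ∈ Finset.range (n + 1),
    C ((j.factorial : ℝ)⁻¹ * iteratedDerivWithin j v (Set.Icc xl xr) xl) * (X - C xl) ^ j,
    natDegree_sum_le_of_forall_le _ _ fun j hj => ?_, fun t ht => ?_⟩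
  · refine (natDegree_C_mul_le _ _).trans ?_
    rw [natDegree_pow, natDegree_X_sub_C, mul_one]
    exact Nat.lt_succ_iff.1 (Finset.mem_range.1 hj)
  · have h1 := taylor_mean_remainder_bound (f := v) (n := n) (C := M) hx.le hv.contDiffOn ht (by
      intro y hy
      rw [iteratedDerivWithin_eq_iteratedDeriv (uniqueDiffOn_Icc hx)
        (by exact_mod_cast hv.contDiffAt) hy]
      exact hM y hy)
    rw [taylor_within_apply, Real.norm_eq_abs] at h1
    have h2 : (∑ j ∈ Finset.range (n + 1),
        C ((j.factorial : ℝ)⁻¹ * iteratedDerivWithin j v (Set.Icc xl xr) xl) * (X - C xl) ^ j).eval t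
        = ∑ j ∈ Finset.range (n + 1),
          ((j.factorial : ℝ)⁻¹ * (t - xl) ^ j) • iteratedDerivWithin j v (Set.Icc xl xr) xl := by
      rw [eval_finsetSum]
      refine Finset.sum_congr rfl fun j _ => ?_
      simp; ring
    rw [h2]
    refine h1.trans ?_
    have h3 : (1 : ℝ) ≤ n.factorial := by exact_mod_cast n.factorial_pos
    have h4 : 0 ≤ t - xl := sub_nonneg.2 ht.1
    calc M * (t - xl) ^ (n + 1) / n.factorial ≤ M * (t - xl) ^ (n + 1) :=
          div_le_self (by positivity) h3
      _ ≤ M * (xr - xl) ^ (n + 1) := by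
          gcongr
          exact ht.2

theorem abs_sub_le_of_hasDerivAt_of_abs_le {f f' : ℝ → ℝ} {xl xr B : ℝ}
    (hf : ∀ t ∈ Set.Icc xl xr, HasDerivAt f (f' t) t) (hB : ∀ t ∈ Set.Icc xl xr, |f' t| ≤ B)
    {s t : ℝ} (hs : s ∈ Set.Icc xl xr) (ht : t ∈ Set.Icc xl xr) :
    |f t - f s| ≤ B * (xr - xl) := by
  have h := (convex_Icc xl xr).norm_image_sub_le_of_norm_hasDerivWithin_le
    (fun y hy => (hf y hy).hasDerivWithinAt) hB hs ht
  have hB0 : 0 ≤ B := (abs_nonneg _).trans (hB s hs)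
  refine h.trans (mul_le_mul_of_nonneg_left ?_ hB0)
  rw [Real.norm_eq_abs, abs_le]
  constructor <;> linarith [hs.1, hs.2, ht.1, ht.2]

theorem iteratedDeriv_iteratedDeriv_two (m : ℕ) (u : ℝ → ℝ) :
    iteratedDeriv m (iteratedDeriv 2 u) = iteratedDeriv (m + 2) u := by
  simp only [iteratedDeriv_eq_iterate, Function.iterate_add_apply]

open Polynomial in
/-- Consistency of the truncated Jacobi projection on one element. -/
theorem exists_bound_elemProj_error (k : ℕ) (hk : 3 ≤ k) :
    ∃ K > 0, ∀ (u : ℝ → ℝ) (xl xr M : ℝ) (p : ℝ[X]), ContDiff ℝ (2 * k) u → xl < xr →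
      IsElemProj k u xl xr p →
      (∀ j ≤ 2 * k, ∀ y ∈ Set.Icc xl xr, |iteratedDeriv j u y| ≤ M) →
      (∀ t ∈ Set.Icc xl xr, |u t - p.eval t| ≤ K * (xr - xl) ^ (k + 1) * M) ∧
      (∀ t ∈ Set.Icc xl xr, |deriv u t - (derivative p).eval t| ≤ K * (xr - xl) ^ k * M) ∧
      ∀ s ∈ Set.Icc (-1 : ℝ) 1, legendre (k - 1) s = 0 →
        |iteratedDeriv 2 u (affMap xl xr s)
          - (derivative (derivative p)).eval (affMap xl xr s)| ≤ K * (xr - xl) ^ k * M := by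
  obtain ⟨K, hK, h⟩ := exists_bound_element_projection_error (k - 1)
  refine ⟨K, hK, fun u xl xr M p hu hx hp hM => ?_⟩
  obtain ⟨hp0, hp1, -, hp2, -, hp3⟩ := hp
  have hl : xl ∈ Set.Icc xl xr := ⟨le_rfl, hx.le⟩
  have hM0 : 0 ≤ M := (abs_nonneg _).trans (hM 0 (by omega) xl hl)
  have hH : 0 < xr - xl := sub_pos.2 hx
  have hv : ∀ m : ℕ, m + 2 ≤ 2 * k → ContDiff ℝ m (iteratedDeriv 2 u) := fun m hm => by
    rw [iteratedDeriv_eq_iterate]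
    exact ContDiff.iterate_deriv' m 2 (hu.of_le (by exact_mod_cast hm))
  have hvc : Continuous (iteratedDeriv 2 u) := (hv 0 (by omega)).continuous
  have hu0 : ∀ t, HasDerivAt u (deriv u t) t := fun t =>
    (hu.differentiable (by simp; omega) t).hasDerivAt
  have hu1 : ∀ t, HasDerivAt (deriv u) (iteratedDeriv 2 u t) t := fun t => by
    have h1 : ContDiff ℝ 1 (deriv u) := by
      have := ContDiff.iterate_deriv' 1 1 (hu.of_le (by norm_cast; omega))
      simpa using this
    rw [iteratedDeriv_succ, iteratedDeriv_one]
    exact (h1.differentiable one_ne_zero t).hasDerivAt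
  have hdeg : (derivative (derivative p)).degree < ((k - 1 : ℕ) : WithBot ℕ) := by
    refine degree_le_natDegree.trans_lt ?_
    have h1 := natDegree_derivative_le p
    have h2 := natDegree_derivative_le (derivative p)
    exact_mod_cast (by omega : (derivative (derivative p)).natDegree < k - 1)
  obtain ⟨h1, h2⟩ := h (iteratedDeriv 2 u) (derivative (derivative p)) xl xr hvc hdeg hx
    fun q hq => hp3 q (by omega)
  obtain ⟨T₁, hT₁, hT₁'⟩ := exists_taylor_polynomial (v := iteratedDeriv 2 u) (n := k - 2)
    (by exact_mod_cast hv (k - 2 + 1) (by omega)) hx (M := M) (fun y hy => by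
      rw [iteratedDeriv_iteratedDeriv_two]; exact hM _ (by omega) y hy)
  obtain ⟨T₂, hT₂, hT₂'⟩ := exists_taylor_polynomial (v := iteratedDeriv 2 u) (n := k - 1)
    (by exact_mod_cast hv (k - 1 + 1) (by omega)) hx (M := M) (fun y hy => by
      rw [iteratedDeriv_iteratedDeriv_two]; exact hM _ (by omega) y hy)
  rw [show k - 2 + 1 = k - 1 by omega] at hT₁'
  rw [show k - 1 + 1 = k by omega] at hT₂'
  have e2 := h1 T₁ (M * (xr - xl) ^ (k - 1)) (degree_le_natDegree.trans_lt
    (by exact_mod_cast (by omega : T₁.natDegree < k - 1))) (by positivity) hT₁'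
  have e1 : ∀ t ∈ Set.Icc xl xr,
      |deriv u t - (derivative p).eval t| ≤ K * (xr - xl) ^ k * M := fun t ht => by
    have h3 := abs_sub_le_of_hasDerivAt_of_abs_le
      (fun t _ => (hu1 t).sub ((derivative p).hasDerivAt t)) e2 hl ht
    simp only [Pi.sub_apply, hp2, sub_self, sub_zero] at h3
    refine h3.trans_eq ?_
    obtain ⟨k, rfl⟩ : ∃ j, k = j + 1 := ⟨k - 1, by omega⟩
    rw [Nat.add_sub_cancel]
    ring
  refine ⟨fun t ht => ?_, e1, fun s hs hls => ?_⟩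
  · have h3 := abs_sub_le_of_hasDerivAt_of_abs_le
      (fun t _ => (hu0 t).sub (p.hasDerivAt t)) e1 hl ht
    simp only [Pi.sub_apply, hp1, sub_self, sub_zero] at h3
    exact h3.trans_eq (by ring)
  · exact (h2 T₂ _ hT₂ (by positivity) hT₂' s hs hls).trans_eq (by ring)

open Polynomial in
/-- A polynomial whose residual is small at the Gauss points has a small residual on the whole
element, up to a term of higher order. -/
theorem exists_bound_residual (k : ℕ) (hk : 3 ≤ k) (α β γ : ℝ) :
    ∃ K > 0, ∀ (e : ℝ[X]) (xl xr ε S : ℝ), e.natDegree ≤ k → xl < xr → 0 ≤ ε →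
      (∀ s ∈ Set.Ioo (-1 : ℝ) 1, legendre (k - 1) s = 0 →
        |-α * (derivative (derivative e)).eval (affMap xl xr s)
          + β * (derivative e).eval (affMap xl xr s) + γ * e.eval (affMap xl xr s)| ≤ ε) →
      (∀ t ∈ Set.Icc xl xr, |(derivative e).eval t| ≤ S) →
      (∀ t ∈ Set.Icc xl xr, |(derivative (derivative e)).eval t| ≤ S) →
      ∀ t ∈ Set.Icc xl xr, |-α * (derivative (derivative e)).eval t
          + β * (derivative e).eval t + γ * e.eval t|
        ≤ K * (ε + (xr - xl) * S) := by
  obtain ⟨K, hK, h⟩ := exists_bound_of_element_gauss_points (k - 1)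
  refine ⟨(K + 1) * (1 + |β| + |γ|), by positivity, fun e xl xr ε S he hx hε hg h1 h2 t ht => ?_⟩
  have hl : xl ∈ Set.Icc xl xr := ⟨le_rfl, hx.le⟩
  have hS : 0 ≤ S := (abs_nonneg _).trans (h1 xl hl)
  have hH : 0 < xr - xl := sub_pos.2 hx
  have d0 : ∀ t ∈ Set.Icc xl xr, |γ * (e.eval t - e.eval xl)| ≤ |γ| * (S * (xr - xl)) :=
    fun t ht => by
      rw [abs_mul]
      exact mul_le_mul_of_nonneg_left (abs_sub_le_of_hasDerivAt_of_abs_le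
        (fun t _ => e.hasDerivAt t) h1 hl ht) (abs_nonneg _)
  have d1 : ∀ t ∈ Set.Icc xl xr, |β * ((derivative e).eval t - (derivative e).eval xl)|
      ≤ |β| * (S * (xr - xl)) := fun t ht => by
    rw [abs_mul]
    exact mul_le_mul_of_nonneg_left (abs_sub_le_of_hasDerivAt_of_abs_le
      (fun t _ => (derivative e).hasDerivAt t) h2 hl ht) (abs_nonneg _)
  set q := C (-α) * derivative (derivative e) + C (β * (derivative e).eval xl + γ * e.eval xl)
    with hq
  have hqd : q.degree < ((k - 1 : ℕ) : WithBot ℕ) := by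
    refine degree_le_natDegree.trans_lt ?_
    have h3 := natDegree_derivative_le e
    have h4 := natDegree_derivative_le (derivative e)
    have h5 : q.natDegree ≤ k - 2 := by
      refine natDegree_add_le_of_degree_le ((natDegree_C_mul_le _ _).trans (by omega)) ?_
      exact (natDegree_C _).trans_le (Nat.zero_le _)
    exact_mod_cast (by omega : q.natDegree < k - 1)
  have hqe : ∀ t, q.eval t = (-α * (derivative (derivative e)).eval t
      + β * (derivative e).eval t + γ * e.eval t)
      - β * ((derivative e).eval t - (derivative e).eval xl) - γ * (e.eval t - e.eval xl) := by
    intro t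
    simp only [hq, eval_add, eval_mul, eval_C]; ring
  have h3 := h q xl xr (ε + |β| * (S * (xr - xl)) + |γ| * (S * (xr - xl))) hqd hx (by positivity)
    (fun s hs hls => by
      have hm := affMap_mem_Icc hx (Set.Ioo_subset_Icc_self hs)
      have i0 := abs_le.1 (d0 _ hm)
      have i1 := abs_le.1 (d1 _ hm)
      have i2 := abs_le.1 (hg s hs hls)
      rw [hqe, abs_le]
      constructor <;> linarith) t ht
  have i0 := abs_le.1 (d0 _ ht)
  have i1 := abs_le.1 (d1 _ ht)
  rw [hqe] at h3
  have i3 := abs_le.1 h3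
  have hy : 0 ≤ S * (xr - xl) := by positivity
  have hb : (K + 1) * (ε + |β| * (S * (xr - xl)) + |γ| * (S * (xr - xl)))
      ≤ (K + 1) * (1 + |β| + |γ|) * (ε + (xr - xl) * S) := by
    rw [mul_assoc]
    refine mul_le_mul_of_nonneg_left ?_ (by positivity)
    nlinarith [mul_nonneg (abs_nonneg β) hε, mul_nonneg (abs_nonneg γ) hε]
  refine le_trans (abs_le.2 ⟨?_, ?_⟩) hb <;> nlinarith

/-- `E` is of class `C¹` with derivative `E₁`, and `E₁` has the right derivative `E₂`. -/
def HasRightSecondDeriv (E E₁ E₂ : ℝ → ℝ) : Prop :=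
  (∀ t, HasDerivAt E (E₁ t) t) ∧ Continuous E₁ ∧ ∀ t, HasDerivWithinAt E₁ (E₂ t) (Set.Ici t) t

theorem HasRightSecondDeriv.glue {F F₁ F₂ G G₁ G₂ : ℝ → ℝ} {c : ℝ}
    (hF : HasRightSecondDeriv F F₁ F₂) (hG : HasRightSecondDeriv G G₁ G₂)
    (h0 : F c = G c) (h1 : F₁ c = G₁ c) :
    HasRightSecondDeriv (fun t => if c ≤ t then G t else F t)
      (fun t => if c ≤ t then G₁ t else F₁ t) (fun t => if c ≤ t then G₂ t else F₂ t) := by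
  have hlt : ∀ {t : ℝ}, t < c → ∀ f g : ℝ → ℝ,
      (fun t => if c ≤ t then g t else f t) =ᶠ[nhds t] f := fun ht f g => by
    filter_upwards [Iio_mem_nhds ht] with y hy
    exact if_neg (not_le.2 hy)
  refine ⟨fun t => ?_, ?_, fun t => ?_⟩
  · rcases lt_trichotomy t c with ht | rfl | ht
    · simp only [not_le.2 ht, if_false]
      exact (hF.1 t).congr_of_eventuallyEq (hlt ht F G)
    · simp only [le_refl, if_true]
      rw [← hasDerivWithinAt_univ, ← Set.Iic_union_Ici (a := t)]
      refine HasDerivWithinAt.union ?_ ?_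
      · rw [← h1]
        refine (hF.1 t).hasDerivWithinAt.congr (fun y hy => ?_) (by simp [h0])
        rcases (show y ≤ t from hy).eq_or_lt with rfl | hy
        · simp [h0]
        · simp [not_le.2 hy]
      · exact (hG.1 t).hasDerivWithinAt.congr (fun y hy => if_pos hy) (by simp)
    · simp only [ht.le, if_true]
      refine (hG.1 t).congr_of_eventuallyEq ?_
      filter_upwards [Ioi_mem_nhds ht] with y hy
      exact if_pos (le_of_lt hy)
  · exact Continuous.if_le hG.2.1 hF.2.1 continuous_const continuous_id fun t ht => by
      have : c = t := ht
      rw [← this, h1]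
  · rcases lt_or_ge t c with ht | ht
    · simp only [not_le.2 ht, if_false]
      exact (hF.2.2 t).congr_of_eventuallyEq ((hlt ht F₁ G₁).filter_mono nhdsWithin_le_nhds)
        (by simp [not_le.2 ht])
    · simp only [ht, if_true]
      exact (hG.2.2 t).congr (fun y hy => if_pos (ht.trans hy)) (by simp [ht])

open Polynomial in
theorem hasRightSecondDeriv_polynomial (p : ℝ[X]) :
    HasRightSecondDeriv (fun t => p.eval t) (fun t => (derivative p).eval t)
      (fun t => (derivative (derivative p)).eval t) :=
  ⟨p.hasDerivAt, (derivative p).continuous, fun t => ((derivative p).hasDerivAt t).hasDerivWithinAt⟩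

theorem mesh_le {N : ℕ} {x : ℕ → ℝ} (hx : ∀ i < N, x i < x (i + 1)) :
    ∀ j ≤ N, ∀ i ≤ j, x i ≤ x j := by
  intro j
  induction j with
  | zero =>
    intro _ i hi
    rw [Nat.le_zero.1 hi]
  | succ j ih =>
    intro hj i hi
    rcases Nat.lt_or_eq_of_le hi with hi' | rfl
    · exact (ih (by omega) i (by omega)).trans (hx j (by omega)).le
    · exact le_rfl

open Polynomial in
/-- A `C¹` piecewise polynomial as a function on the real line. -/
theorem exists_glued_function {N : ℕ} (hN : 1 ≤ N) {x : ℕ → ℝ} {e : ℕ → ℝ[X]}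
    (hx : ∀ i < N, x i < x (i + 1))
    (h0 : ∀ i ∈ Finset.Icc 1 (N - 1), (e i).eval (x i) = (e (i + 1)).eval (x i))
    (h1 : ∀ i ∈ Finset.Icc 1 (N - 1),
      (derivative (e i)).eval (x i) = (derivative (e (i + 1))).eval (x i)) :
    ∃ E E₁ E₂ : ℝ → ℝ, HasRightSecondDeriv E E₁ E₂ ∧
      (∀ i ∈ Finset.Icc 1 N, ∀ t ∈ Set.Icc (x (i - 1)) (x i),
        E t = (e i).eval t ∧ E₁ t = (derivative (e i)).eval t) ∧
      ∀ t ∈ Set.Ico (x 0) (x N), ∃ i ∈ Finset.Icc 1 N, t ∈ Set.Icc (x (i - 1)) (x i) ∧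
        E₂ t = (derivative (derivative (e i))).eval t := by
  induction N, hN using Nat.le_induction with
  | base =>
    refine ⟨_, _, _, hasRightSecondDeriv_polynomial (e 1), fun i hi t _ => ?_, fun t ht =>
      ⟨1, by simp, Set.Ico_subset_Icc_self ht, rfl⟩⟩
    obtain rfl : i = 1 := by simpa using hi
    exact ⟨rfl, rfl⟩
  | succ N hN ih =>
    obtain ⟨F, F₁, F₂, hF, hFe, hFe₂⟩ := ih (fun i hi => hx i (by omega))
      (fun i hi => h0 i (by simp only [Finset.mem_Icc] at hi ⊢; omega))
      (fun i hi => h1 i (by simp only [Finset.mem_Icc] at hi ⊢; omega))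
    have hNN : N ∈ Finset.Icc 1 (N + 1 - 1) := by simp only [Finset.mem_Icc]; omega
    have hmono := mesh_le (fun i hi => hx i (by omega)) N le_rfl
    have hNI : x N ∈ Set.Icc (x (N - 1)) (x N) := ⟨hmono _ (by omega), le_rfl⟩
    have hN' := hFe N (by simp only [Finset.mem_Icc]; omega) _ hNI
    refine ⟨_, _, _, hF.glue (hasRightSecondDeriv_polynomial (e (N + 1)))
      (hN'.1.trans (h0 N hNN)) (hN'.2.trans (h1 N hNN)), fun i hi t ht => ?_, fun t ht => ?_⟩
    · by_cases hiN : i = N + 1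
      · subst hiN
        have : x N ≤ t := by simpa using ht.1
        simp [this]
      · have hi' : i ∈ Finset.Icc 1 N := by simp only [Finset.mem_Icc] at hi ⊢; omega
        have hiN' : i ≤ N := (Finset.mem_Icc.1 hi').2
        have hFt := hFe i hi' t ht
        by_cases hxt : x N ≤ t
        · have hxi : t = x N := le_antisymm (ht.2.trans (hmono i hiN')) hxt
          have hFN := hN'
          rw [h0 N hNN, h1 N hNN, ← hxi] at hFN
          simp only [hxt, if_true]
          exact ⟨hFN.1.symm.trans hFt.1, hFN.2.symm.trans hFt.2⟩
        · simp only [hxt, if_false]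
          exact hFt
    · by_cases hxt : x N ≤ t
      · exact ⟨N + 1, by simp, ⟨by simpa using hxt, ht.2.le⟩, by simp [hxt]⟩
      · obtain ⟨i, hi, hti, hE⟩ := hFe₂ t ⟨ht.1, not_le.1 hxt⟩
        exact ⟨i, by simp only [Finset.mem_Icc] at hi ⊢; omega, hti, by simp [hxt, hE]⟩

/-- Maximum principle for `-α w'' + β w' + γ w`. -/
theorem HasRightSecondDeriv.nonpos {w w₁ w₂ : ℝ → ℝ} (hw : HasRightSecondDeriv w w₁ w₂)
    {α β γ a b : ℝ} (hα : 0 < α) (hγ : 0 ≤ γ) (ha : w a ≤ 0) (hb : w b ≤ 0)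
    (h : ∀ t ∈ Set.Ioo a b, -α * w₂ t + β * w₁ t + γ * w t < 0) :
    ∀ t ∈ Set.Icc a b, w t ≤ 0 := by
  intro t ht
  by_contra! hpos
  have hcont : Continuous w := continuous_iff_continuousAt.2 fun t => (hw.1 t).continuousAt
  obtain ⟨m, hm, hmax⟩ := isCompact_Icc.exists_isMaxOn ⟨t, ht⟩ hcont.continuousOn
  have hwm : 0 < w m := hpos.trans_le (hmax ht)
  have hma : a < m := lt_of_le_of_ne hm.1 fun h => by rw [← h] at hwm; linarith
  have hmb : m < b := lt_of_le_of_ne hm.2 fun h => by rw [h] at hwm; linarith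
  have h1 : w₁ m = 0 := (hmax.isLocalMax (Icc_mem_nhds hma hmb)).hasDerivAt_eq_zero (hw.1 m)
  have h2 : 0 < w₂ m := by
    have := h m ⟨hma, hmb⟩
    rw [h1] at this
    have h3 : 0 ≤ γ * w m := by positivity
    by_contra! h4
    nlinarith
  have h3 := (hw.2.2 m).Ioi_of_Ici
  rw [hasDerivWithinAt_iff_tendsto_slope' (by simp)] at h3
  have h4 := (h3.eventually (lt_mem_nhds h2)).and (Ioo_mem_nhdsGT hmb)
  obtain ⟨y, hy, hy'⟩ := (mem_nhdsGT_iff_exists_Ioo_subset.1 h4)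
  have hmy : m < y := hy
  obtain ⟨ξ, hξ, hξ'⟩ := exists_hasDerivAt_eq_slope w w₁ (a := m) (b := (m + min y b) / 2)
    (by have := lt_min hmy hmb; linarith) hcont.continuousOn (fun t _ => hw.1 t)
  have hmin := lt_min hmy hmb
  have hξy : ξ ∈ Set.Ioo m y := ⟨hξ.1, by have := min_le_left y b; linarith [hξ.2]⟩
  have h5 := (hy' hξy).1
  rw [slope_def_field, h1, sub_zero] at h5
  have h6 : 0 < w₁ ξ := by
    have := sub_pos.2 hξ.1
    by_contra! h7
    exact absurd h5 (not_lt.2 (div_nonpos_of_nonpos_of_nonneg h7 this.le))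
  rw [hξ'] at h6
  have h7 : w ((m + min y b) / 2) ≤ w m :=
    hmax ⟨by linarith, by have := min_le_right y b; linarith⟩
  exact absurd h6 (not_lt.2 (div_nonpos_of_nonpos_of_nonneg (by linarith) (by linarith)))

theorem exists_barrier (α β γ d : ℝ) (hα : 0 < α) (hγ : 0 ≤ γ) :
    ∃ A > 0, ∀ a b : ℝ, b - a = d → ∃ ψ ψ₁ ψ₂ : ℝ → ℝ,
      (∀ t, HasDerivAt ψ (ψ₁ t) t) ∧ (∀ t, HasDerivAt ψ₁ (ψ₂ t) t) ∧
      ∀ t ∈ Set.Icc a b, 0 ≤ ψ t ∧ ψ t ≤ A ∧ 1 ≤ -α * ψ₂ t + β * ψ₁ t + γ * ψ t := by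
  set l := (|β| + 1) / α + 1 with hl
  have hl1 : 1 ≤ l := by
    have : 0 ≤ (|β| + 1) / α := by positivity
    linarith
  have hl2 : 1 ≤ α * l - β := by
    have : α * l = |β| + 1 + α := by rw [hl]; field_simp
    linarith [le_abs_self β]
  refine ⟨Real.exp (l * d), Real.exp_pos _, fun a b hab =>
    ⟨fun t => Real.exp (l * d) - Real.exp (l * (t - a)), fun t => -(l * Real.exp (l * (t - a))),
      fun t => -(l * (l * Real.exp (l * (t - a)))), ?_, ?_, ?_⟩⟩
  · intro t
    have := ((((hasDerivAt_id t).sub_const a).const_mul l).exp).const_sub (Real.exp (l * d))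
    exact this.congr_deriv (by simp; ring)
  · intro t
    have := (((((hasDerivAt_id t).sub_const a).const_mul l).exp).const_mul l).neg
    exact this.congr_deriv (by simp only [id]; ring)
  · intro t ht
    have h1 : 1 ≤ Real.exp (l * (t - a)) :=
      Real.one_le_exp (mul_nonneg (by linarith) (by linarith [ht.1]))
    have h2 : Real.exp (l * (t - a)) ≤ Real.exp (l * d) :=
      Real.exp_le_exp.2 (mul_le_mul_of_nonneg_left (by linarith [ht.2]) (by linarith))
    refine ⟨by linarith, by linarith, ?_⟩
    have h3 : 0 ≤ γ * (Real.exp (l * d) - Real.exp (l * (t - a))) :=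
      mul_nonneg hγ (by linarith)
    have h4 : 1 ≤ l * (α * l - β) := by nlinarith
    have h5 : 1 ≤ l * (α * l - β) * Real.exp (l * (t - a)) := by nlinarith
    nlinarith

theorem exists_bound_apriori (α β γ d : ℝ) (hα : 0 < α) (hγ : 0 ≤ γ) (hd : 0 < d) :
    ∃ K > 0, ∀ (a b R : ℝ) (E E₁ E₂ : ℝ → ℝ), b - a = d → HasRightSecondDeriv E E₁ E₂ →
      E a = 0 → E b = 0 → 0 ≤ R →
      (∀ t ∈ Set.Ico a b, |-α * E₂ t + β * E₁ t + γ * E t| ≤ R) →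
      ∀ t ∈ Set.Icc a b, |E t| ≤ K * R ∧ |E₁ t| ≤ K * R := by
  obtain ⟨A, hA, hbar⟩ := exists_barrier α β γ d hα hγ
  set Q := Real.exp (|β| / α * d) with hQ
  have hQ0 : 0 < Q := Real.exp_pos _
  refine ⟨A + 2 * d * Q ^ 2 * (γ * A + 1) / α, by positivity,
    fun a b R E E₁ E₂ hab hE hEa hEb hR hres => ?_⟩
  have hlt : a < b := by linarith
  have hE0 : ∀ t ∈ Set.Icc a b, |E t| ≤ A * R := by
    obtain ⟨ψ, ψ₁, ψ₂, hψ, hψ₁, hψb⟩ := hbar a b hab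
    have key : ∀ σ : ℝ, |σ| ≤ 1 → ∀ R' > R, ∀ t ∈ Set.Icc a b, σ * E t ≤ R' * A := by
      intro σ hσ R' hR' t ht
      have hw : HasRightSecondDeriv (fun t => σ * E t - R' * ψ t)
          (fun t => σ * E₁ t - R' * ψ₁ t) (fun t => σ * E₂ t - R' * ψ₂ t) :=
        ⟨fun t => ((hE.1 t).const_mul σ).sub ((hψ t).const_mul R'),
          (hE.2.1.const_mul σ).sub ((continuous_iff_continuousAt.2
            fun t => (hψ₁ t).continuousAt).const_mul R'),
          fun t => ((hE.2.2 t).const_mul σ).sub ((hψ₁ t).hasDerivWithinAt.const_mul R')⟩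
      have hR0 : 0 < R' := hR.trans_lt hR'
      have h1 := hw.nonpos (β := β) hα hγ (a := a) (b := b)
        (by
          have := (hψb a ⟨le_rfl, hlt.le⟩).1
          simp only [hEa, mul_zero, zero_sub, neg_nonpos]; positivity)
        (by
          have := (hψb b ⟨hlt.le, le_rfl⟩).1
          simp only [hEb, mul_zero, zero_sub, neg_nonpos]; positivity)
        (by
          intro t ht
          have h2 := hres t ⟨ht.1.le, ht.2⟩
          have h3 := (hψb t ⟨ht.1.le, ht.2.le⟩).2.2
          have h4 : σ * (-α * E₂ t + β * E₁ t + γ * E t) ≤ R := by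
            refine (le_abs_self _).trans ?_
            rw [abs_mul]
            nlinarith [abs_nonneg σ, abs_nonneg (-α * E₂ t + β * E₁ t + γ * E t)]
          nlinarith) t ht
      have h2 := (hψb t ht).2.1
      nlinarith
    intro t ht
    by_contra! hcon
    have hRA : R < |E t| / A := by rw [lt_div_iff₀ hA]; linarith
    have h1 := key 1 (by simp) ((R + |E t| / A) / 2) (by linarith) t ht
    have h2 := key (-1) (by simp) ((R + |E t| / A) / 2) (by linarith) t ht
    have h3 : (R + |E t| / A) / 2 * A = (A * R + |E t|) / 2 := by field_simp
    rw [h3] at h1 h2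
    have : |E t| ≤ (A * R + |E t|) / 2 := abs_le.2 ⟨by linarith, by linarith⟩
    linarith
  have hAR : A * R ≤ (A + 2 * d * Q ^ 2 * (γ * A + 1) / α) * R := by
    gcongr
    have : 0 ≤ 2 * d * Q ^ 2 * (γ * A + 1) / α := by positivity
    linarith
  refine fun t ht => ⟨(hE0 t ht).trans hAR, ?_⟩
  set ρ : ℝ → ℝ := fun t => Real.exp (-(β / α) * (t - a)) with hρ
  have hρd : ∀ t, HasDerivAt ρ (-(β / α) * ρ t) t := fun t => by
    have := (((hasDerivAt_id t).sub_const a).const_mul (-(β / α))).exp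
    exact this.congr_deriv (by simp [hρ]; ring)
  have hexp : ∀ t ∈ Set.Icc a b, |β / α * (t - a)| ≤ |β| / α * d := fun t ht => by
    rw [abs_mul, abs_div, abs_of_pos hα, abs_of_nonneg (sub_nonneg.2 ht.1)]
    gcongr
    linarith [ht.2]
  have hρQ : ∀ t ∈ Set.Icc a b, ρ t ≤ Q := fun t ht =>
    Real.exp_le_exp.2 (by linarith [(abs_le.1 (hexp t ht)).1])
  have hρQ' : ∀ t ∈ Set.Icc a b, 1 ≤ ρ t * Q := fun t ht => by
    rw [hρ, hQ, ← Real.exp_add]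
    exact Real.one_le_exp (by linarith [(abs_le.1 (hexp t ht)).2])
  have hρ0 : ∀ t, 0 < ρ t := fun t => Real.exp_pos _
  set B := Q * ((γ * A + 1) * R / α) with hB
  have hB0 : 0 ≤ B := by positivity
  have hg := norm_image_sub_le_of_norm_deriv_right_le_segment (f := fun t => ρ t * E₁ t)
    (f' := fun t => -(β / α) * ρ t * E₁ t + ρ t * E₂ t) (a := a) (b := b) (C := B)
    ((continuous_iff_continuousAt.2 fun t => (hρd t).continuousAt).mul hE.2.1).continuousOn
    (fun t _ => (hρd t).hasDerivWithinAt.mul (hE.2.2 t))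
    (by
      intro t ht
      have ht' := Set.Ico_subset_Icc_self ht
      have h1 : -(β / α) * ρ t * E₁ t + ρ t * E₂ t
          = ρ t * ((γ * E t - (-α * E₂ t + β * E₁ t + γ * E t)) / α) := by
        field_simp; ring
      rw [h1, Real.norm_eq_abs, abs_mul, abs_of_pos (hρ0 t), abs_div, abs_of_pos hα]
      have h2 : |γ * E t - (-α * E₂ t + β * E₁ t + γ * E t)| ≤ (γ * A + 1) * R := by
        refine (abs_sub _ _).trans ?_
        rw [abs_mul, abs_of_nonneg hγ]
        nlinarith [hres t ht, mul_le_mul_of_nonneg_left (hE0 t ht') hγ]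
      rw [hB]
      have := hρQ t ht'
      gcongr)
  have hgd : ∀ t ∈ Set.Icc a b, |ρ t * E₁ t - ρ a * E₁ a| ≤ B * d := fun t ht =>
    (hg t ht).trans (mul_le_mul_of_nonneg_left (by linarith [ht.2]) hB0)
  obtain ⟨ξ, hξ, hξ0⟩ := exists_hasDerivAt_eq_zero hlt
    (continuous_iff_continuousAt.2 fun t => (hE.1 t).continuousAt).continuousOn
    (hEa.trans hEb.symm) (fun t _ => hE.1 t)
  have h1 := abs_le.1 (hgd ξ (Set.Ioo_subset_Icc_self hξ))
  rw [hξ0, mul_zero, zero_sub] at h1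
  have h2 := abs_le.1 (hgd t ht)
  have h3 : |ρ t * E₁ t| ≤ 2 * (B * d) := abs_le.2 ⟨by linarith, by linarith⟩
  rw [abs_mul, abs_of_pos (hρ0 t)] at h3
  calc |E₁ t| = 1 * |E₁ t| := (one_mul _).symm
    _ ≤ ρ t * Q * |E₁ t| := by gcongr; exact hρQ' t ht
    _ = Q * (ρ t * |E₁ t|) := by ring
    _ ≤ Q * (2 * (B * d)) := by gcongr
    _ = 2 * d * Q ^ 2 * (γ * A + 1) / α * R := by rw [hB]; ring
    _ ≤ (A + 2 * d * Q ^ 2 * (γ * A + 1) / α) * R := by gcongr; linarith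

open Polynomial in
/-- Stability of Gauss collocation: a member of `V_h^0` whose residual at the Gauss points is at
most `ε` is of size `O(ε)` together with its first two elementwise derivatives. -/
theorem exists_stability_bound (k : ℕ) (hk : 3 ≤ k) {α β γ d : ℝ} (hα : 0 < α) (hγ : 0 ≤ γ)
    (hd : 0 < d) :
    ∃ C > 0, ∃ h₀ > 0, ∀ (a b : ℝ), b - a = d → ∀ (N : ℕ) (x : ℕ → ℝ) (h ε : ℝ),
      IsMesh a b N x → (∀ i ∈ Finset.Icc 1 N, x i - x (i - 1) ≤ h) → h ≤ h₀ → 0 ≤ ε →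
      ∀ e : ℕ → ℝ[X], IsVh0 k N x e →
      (∀ i ∈ Finset.Icc 1 N, ∀ s ∈ Set.Ioo (-1 : ℝ) 1, legendre (k - 1) s = 0 →
        |-α * (derivative (derivative (e i))).eval (affMap (x (i - 1)) (x i) s)
          + β * (derivative (e i)).eval (affMap (x (i - 1)) (x i) s)
          + γ * (e i).eval (affMap (x (i - 1)) (x i) s)| ≤ ε) →
      ∀ i ∈ Finset.Icc 1 N, ∀ t ∈ Set.Icc (x (i - 1)) (x i),
        |(e i).eval t| ≤ C * ε ∧ |(derivative (e i)).eval t| ≤ C * ε ∧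
          |(derivative (derivative (e i))).eval t| ≤ C * ε := by
  obtain ⟨K₂, hK₂, hres⟩ := exists_bound_residual k hk α β γ
  obtain ⟨K₃, hK₃, hap⟩ := exists_bound_apriori α β γ d hα hγ hd
  set D : ℝ := K₃ + (1 + |β| * K₃ + γ * K₃) / α with hD
  have hD' : 0 < (1 + |β| * K₃ + γ * K₃) / α := by positivity
  have hDpos : 0 < D := by positivity
  refine ⟨2 * D * K₂, by positivity, 1 / (2 * D * K₂), by positivity, ?_⟩
  intro a b hab N x h ε hmesh hsize hh hε e he hG
  obtain ⟨hN, hxa, hxb, hx⟩ := hmesh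
  obtain ⟨hdeg, h0, h1, hl, hr⟩ := he
  have hstep : ∀ i ∈ Finset.Icc 1 N, x (i - 1) < x i := fun i hi => by
    obtain ⟨h1i, hiN⟩ := Finset.mem_Icc.1 hi
    simpa [Nat.sub_add_cancel h1i] using hx (i - 1) (by omega)
  have hmax : ∀ i ∈ Finset.Icc 1 N, ∃ t ∈ Set.Icc (x (i - 1)) (x i),
      ∀ s ∈ Set.Icc (x (i - 1)) (x i),
        |(derivative (e i)).eval s| + |(derivative (derivative (e i))).eval s| ≤
          |(derivative (e i)).eval t| + |(derivative (derivative (e i))).eval t| := fun i hi =>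
    isCompact_Icc.exists_isMaxOn (Set.nonempty_Icc.2 (hstep i hi).le)
      (((derivative (e i)).continuous.abs.add
        (derivative (derivative (e i))).continuous.abs).continuousOn)
  choose! τ hτ hτmax using hmax
  obtain ⟨m, hm, hmmax⟩ := Finset.exists_max_image (Finset.Icc 1 N)
    (fun i => |(derivative (e i)).eval (τ i)| + |(derivative (derivative (e i))).eval (τ i)|)
    ⟨1, by simpa using hN⟩
  set S := |(derivative (e m)).eval (τ m)| + |(derivative (derivative (e m))).eval (τ m)| with hS
  have hS0 : 0 ≤ S := by positivity
  have hh0 : 0 ≤ h := by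
    have := hsize 1 (by simpa using hN)
    linarith [hstep 1 (by simpa using hN)]
  have hSle : ∀ i ∈ Finset.Icc 1 N, ∀ t ∈ Set.Icc (x (i - 1)) (x i),
      |(derivative (e i)).eval t| + |(derivative (derivative (e i))).eval t| ≤ S :=
    fun i hi t ht => (hτmax i hi t ht).trans (hmmax i hi)
  set R := K₂ * (ε + h * S) with hR
  have hR0 : 0 ≤ R := by positivity
  have hLR : ∀ i ∈ Finset.Icc 1 N, ∀ t ∈ Set.Icc (x (i - 1)) (x i),
      |-α * (derivative (derivative (e i))).eval t + β * (derivative (e i)).eval t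
        + γ * (e i).eval t| ≤ R := fun i hi t ht => by
    refine (hres (e i) _ _ ε S (hdeg i hi) (hstep i hi) hε (hG i hi)
      (fun t ht => ?_) (fun t ht => ?_) t ht).trans ?_
    · linarith [hSle i hi t ht, abs_nonneg ((derivative (derivative (e i))).eval t)]
    · linarith [hSle i hi t ht, abs_nonneg ((derivative (e i)).eval t)]
    · have := mul_le_mul_of_nonneg_right (hsize i hi) hS0
      exact mul_le_mul_of_nonneg_left (by linarith) hK₂.le
  obtain ⟨E, E₁, E₂, hE, hEe, hE₂⟩ := exists_glued_function hN hx h0 h1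
  have h1N : 1 ∈ Finset.Icc 1 N := by simpa using hN
  have hNN : N ∈ Finset.Icc 1 N := by simpa using hN
  have hEa : E a = 0 := by
    rw [← hxa, (hEe 1 h1N (x 0) ⟨le_rfl, (hstep 1 h1N).le⟩).1, hl]
  have hEb : E b = 0 := by
    rw [← hxb, (hEe N hNN (x N) ⟨(hstep N hNN).le, le_rfl⟩).1, hr]
  have hbound := hap a b R E E₁ E₂ hab hE hEa hEb hR0 fun t ht => by
    rw [← hxa, ← hxb] at ht
    obtain ⟨i, hi, hti, hEt⟩ := hE₂ t ht
    rw [hEt, (hEe i hi t hti).1, (hEe i hi t hti).2]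
    exact hLR i hi t hti
  have hbd : ∀ i ∈ Finset.Icc 1 N, ∀ t ∈ Set.Icc (x (i - 1)) (x i),
      |(e i).eval t| ≤ K₃ * R ∧ |(derivative (e i)).eval t| ≤ K₃ * R ∧
        |(derivative (derivative (e i))).eval t| ≤ (1 + |β| * K₃ + γ * K₃) / α * R := by
    intro i hi t ht
    have hiN := (Finset.mem_Icc.1 hi).2
    have hab' : t ∈ Set.Icc a b := by
      rw [← hxa, ← hxb]
      exact ⟨(mesh_le hx (i - 1) (by omega) 0 (by omega)).trans ht.1,
        ht.2.trans (mesh_le hx N le_rfl i hiN)⟩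
    have hb := hbound t hab'
    rw [(hEe i hi t ht).1, (hEe i hi t ht).2] at hb
    refine ⟨hb.1, hb.2, ?_⟩
    have hL := hLR i hi t ht
    set y₂ := (derivative (derivative (e i))).eval t
    set y₁ := (derivative (e i)).eval t
    set y := (e i).eval t
    have h3 : |α * y₂| ≤ R + |β| * (K₃ * R) + γ * (K₃ * R) := by
      calc |α * y₂| = |-(-α * y₂ + β * y₁ + γ * y) + β * y₁ + γ * y| := by ring_nf
        _ ≤ |-(-α * y₂ + β * y₁ + γ * y)| + |β * y₁| + |γ * y| := abs_add_three _ _ _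
        _ ≤ _ := by
          rw [abs_neg, abs_mul, abs_mul, abs_of_nonneg hγ]
          gcongr
          exacts [hb.2, hb.1]
    rw [abs_mul, abs_of_pos hα] at h3
    rw [div_mul_eq_mul_div, le_div_iff₀ hα]
    linarith
  have hSR : S ≤ D * R := by
    have := hbd m hm (τ m) (hτ m hm)
    rw [hD, add_mul]
    exact add_le_add this.2.1 this.2.2
  have hDR : D * R ≤ 2 * D * K₂ * ε := by
    have h2 : h * (2 * D * K₂) ≤ 1 := (le_div_iff₀ (by positivity)).1 hh
    have h3 := mul_le_mul_of_nonneg_right h2 hS0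
    have h4 : D * R = D * K₂ * ε + h * (2 * D * K₂) * S / 2 := by rw [hR]; ring
    linarith
  have hK₃D : K₃ * R ≤ D * R := mul_le_mul_of_nonneg_right (by linarith) hR0
  have hDD : (1 + |β| * K₃ + γ * K₃) / α * R ≤ D * R :=
    mul_le_mul_of_nonneg_right (by linarith) hR0
  intro i hi t ht
  have := hbd i hi t ht
  exact ⟨by linarith, by linarith, by linarith⟩

theorem abs_le_on_Icc_of_abs_le_on_Ioo {f : ℝ → ℝ} (hf : Continuous f) {a b M : ℝ} (hab : a < b)
    (h : ∀ y ∈ Set.Ioo a b, |f y| ≤ M) : ∀ y ∈ Set.Icc a b, |f y| ≤ M := by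
  rw [← closure_Ioo hab.ne]
  exact closure_minimal h (isClosed_le hf.abs continuous_const)

open Polynomial in
/-- Consistency: the truncated Jacobi projection satisfies the collocation equations up to
`O(h^k)`. -/
theorem exists_bound_consistency (k : ℕ) (hk : 3 ≤ k) {α γ : ℝ} (β : ℝ) (hα : 0 < α)
    (hγ : 0 ≤ γ) :
    ∃ K > 0, ∀ (u : ℝ → ℝ) (xl xr h M : ℝ) (p : ℝ[X]), ContDiff ℝ (2 * k) u → xl < xr →
      xr - xl ≤ h → h ≤ 1 → 0 ≤ M → IsElemProj k u xl xr p →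
      (∀ j ≤ 2 * k, ∀ y ∈ Set.Icc xl xr, |iteratedDeriv j u y| ≤ M) →
      ∀ s ∈ Set.Icc (-1 : ℝ) 1, legendre (k - 1) s = 0 →
        |-α * (iteratedDeriv 2 u (affMap xl xr s)
              - (derivative (derivative p)).eval (affMap xl xr s))
          + β * (deriv u (affMap xl xr s) - (derivative p).eval (affMap xl xr s))
          + γ * (u (affMap xl xr s) - p.eval (affMap xl xr s))| ≤ K * (h ^ k * M) := by
  obtain ⟨K, hK, hproj⟩ := exists_bound_elemProj_error k hk
  refine ⟨(α + |β| + γ) * K, by positivity, ?_⟩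
  intro u xl xr h M p hu hlr hxh hh hM hp hb s hs hleg
  obtain ⟨h0, h1, h2⟩ := hproj u xl xr M p hu hlr hp hb
  have ht := affMap_mem_Icc hlr hs
  have h0 := h0 _ ht
  have h1 := h1 _ ht
  have h2 := h2 s hs hleg
  set t := affMap xl xr s
  have hpos : 0 < xr - xl := sub_pos.2 hlr
  have hpow : K * (xr - xl) ^ k * M ≤ K * h ^ k * M := by gcongr
  have hpow' : K * (xr - xl) ^ (k + 1) * M ≤ K * (xr - xl) ^ k * M := by
    gcongr ?_ * M
    exact mul_le_mul_of_nonneg_left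
      (pow_le_pow_of_le_one hpos.le (hxh.trans hh) (Nat.le_succ k)) hK.le
  calc _ ≤ |-α * (iteratedDeriv 2 u t - (derivative (derivative p)).eval t)|
          + |β * (deriv u t - (derivative p).eval t)| + |γ * (u t - p.eval t)| :=
        abs_add_three _ _ _
    _ ≤ α * (K * h ^ k * M) + |β| * (K * h ^ k * M) + γ * (K * h ^ k * M) := by
        rw [abs_mul, abs_mul, abs_mul, abs_neg, abs_of_pos hα, abs_of_nonneg hγ]
        gcongr <;> linarith
    _ = _ := by ring

open Polynomial in
theorem isVh0_sub_elemProj {k N : ℕ} {x : ℕ → ℝ} {u : ℝ → ℝ} {P p : ℕ → ℝ[X]} (hN : 1 ≤ N)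
    (hl : u (x 0) = 0) (hr : u (x N) = 0) (hP : IsVh0 k N x P)
    (hp : ∀ i ∈ Finset.Icc 1 N, IsElemProj k u (x (i - 1)) (x i) (p i)) :
    IsVh0 k N x fun i => P i - p i := by
  obtain ⟨hdeg, h0, h1, hPl, hPr⟩ := hP
  have hnext : ∀ i ∈ Finset.Icc 1 (N - 1), i ∈ Finset.Icc 1 N ∧ i + 1 ∈ Finset.Icc 1 N := by
    intro i hi
    simp only [Finset.mem_Icc] at hi ⊢
    omega
  refine ⟨fun i hi =>
    (natDegree_sub_le_of_le (hdeg i hi) (hp i hi).1).trans (max_self k).le, fun i hi => ?_,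
    fun i hi => ?_, ?_, ?_⟩
  · obtain ⟨hi₁, hi₂⟩ := hnext i hi
    have hL := (hp i hi₁).2.2.1
    have hR := (hp (i + 1) hi₂).2.1
    simp only [Nat.add_sub_cancel] at hR
    rw [eval_sub, eval_sub, hL, hR, h0 i hi]
  · obtain ⟨hi₁, hi₂⟩ := hnext i hi
    have hL := (hp i hi₁).2.2.2.2.1
    have hR := (hp (i + 1) hi₂).2.2.2.1
    simp only [Nat.add_sub_cancel] at hR
    rw [derivative_sub, derivative_sub, eval_sub, eval_sub, hL, hR, h1 i hi]
  · have hL := (hp 1 (by simpa using hN)).2.1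
    simp only [Nat.sub_self] at hL
    rw [eval_sub, hPl, hL, hl, sub_zero]
  · rw [eval_sub, hPr, (hp N (by simpa using hN)).2.2.1, hr, sub_zero]

open Polynomial in
/-- A uniform bound on the elementwise derivatives bounds the broken `H²` norm. -/
theorem sqrt_sum_integral_le {N : ℕ} {x : ℕ → ℝ} {e : ℕ → ℝ[X]} {B : ℝ} (hB : 0 ≤ B)
    (hx : ∀ i < N, x i < x (i + 1))
    (he : ∀ i ∈ Finset.Icc 1 N, ∀ t ∈ Set.Icc (x (i - 1)) (x i),
      |(e i).eval t| ≤ B ∧ |(derivative (e i)).eval t| ≤ B ∧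
        |(derivative (derivative (e i))).eval t| ≤ B) :
    Real.sqrt (∑ i ∈ Finset.Icc 1 N, ∫ t in (x (i - 1))..(x i),
        (((e i).eval t) ^ 2 + ((derivative (e i)).eval t) ^ 2
          + ((derivative (derivative (e i))).eval t) ^ 2))
      ≤ Real.sqrt (3 * (x N - x 0)) * B := by
  have htele : ∑ i ∈ Finset.Icc 1 N, (x i - x (i - 1)) = x N - x 0 := by
    clear hx he
    induction N with
    | zero => simp
    | succ N ih => rw [Finset.sum_Icc_succ_top (by omega), ih, Nat.add_sub_cancel]; ring
  have hsum : ∑ i ∈ Finset.Icc 1 N, ∫ t in (x (i - 1))..(x i),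
        (((e i).eval t) ^ 2 + ((derivative (e i)).eval t) ^ 2
          + ((derivative (derivative (e i))).eval t) ^ 2) ≤ 3 * (x N - x 0) * B ^ 2 := by
    rw [← htele, Finset.mul_sum, Finset.sum_mul]
    refine Finset.sum_le_sum fun i hi => ?_
    obtain ⟨h1i, hiN⟩ := Finset.mem_Icc.1 hi
    have hlr : x (i - 1) ≤ x i := mesh_le hx i hiN _ (by omega)
    calc _ ≤ ∫ _ in (x (i - 1))..(x i), 3 * B ^ 2 := by
          refine integral_mono_on hlr (Continuous.intervalIntegrable (by fun_prop) _ _)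
            intervalIntegrable_const fun t ht => ?_
          obtain ⟨b0, b1, b2⟩ := he i hi t ht
          have b0 := sq_le_sq' (abs_le.1 b0).1 (abs_le.1 b0).2
          have b1 := sq_le_sq' (abs_le.1 b1).1 (abs_le.1 b1).2
          have b2 := sq_le_sq' (abs_le.1 b2).1 (abs_le.1 b2).2
          linarith
      _ = _ := by rw [intervalIntegral.integral_const, smul_eq_mul]; ring
  calc _ ≤ Real.sqrt (3 * (x N - x 0) * B ^ 2) := Real.sqrt_le_sqrt hsum
    _ = _ := by
      have := mesh_le hx N le_rfl 0 (Nat.zero_le N)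
      rw [Real.sqrt_mul (by linarith), Real.sqrt_sq hB]

/-- Supercloseness between the Gauss collocation solution and the truncated Jacobi
projection in the `H²` norm: `‖ū_h - u_I‖_2 ≤ C h^k ‖u‖_{2k,∞}`. -/
theorem gauss_collocation_supercloseness_H2 (k : ℕ) (hk : 3 ≤ k)
    (α β γ c d : ℝ) (hα : 0 < α) (hγ : 0 ≤ γ) (hc : 1 ≤ c) (hd : 0 < d) :
    ∃ C > 0, ∃ h₀ > 0, ∀ (a b : ℝ), b - a = d →
      ∀ (N : ℕ) (x : ℕ → ℝ) (h : ℝ),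
        IsMesh a b N x → IsMeshSize N x h → IsQuasiUniform N x h c → h ≤ h₀ →
      ∀ u : ℝ → ℝ, ContDiff ℝ (2 * k) u → u a = 0 → u b = 0 →
      ∀ Pb : ℕ → Polynomial ℝ,
        IsGaussSol k N x α β γ (fun t => -α * iteratedDeriv 2 u t + β * deriv u t + γ * u t) Pb →
      ∀ p : ℕ → Polynomial ℝ, (∀ i ∈ Finset.Icc 1 N, IsElemProj k u (x (i - 1)) (x i) (p i)) →
      ∀ M : ℝ, (∀ j ≤ 2 * k, ∀ y ∈ Set.Ioo a b, |iteratedDeriv j u y| ≤ M) →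
        Real.sqrt (∑ i ∈ Finset.Icc 1 N, ∫ t in (x (i - 1))..(x i),
              (((Pb i - p i).eval t) ^ 2
                + ((Polynomial.derivative (Pb i - p i)).eval t) ^ 2
                + ((Polynomial.derivative (Polynomial.derivative (Pb i - p i))).eval t) ^ 2))
          ≤ C * h ^ k * M := by
  obtain ⟨C, hC, h₀, hh₀, hstab⟩ := exists_stability_bound (β := β) k hk hα hγ hd
  obtain ⟨K, hK, hcons⟩ := exists_bound_consistency k hk β hα hγ
  refine ⟨Real.sqrt (3 * d) * (C * K), by positivity, min h₀ 1, by positivity, ?_⟩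
  intro a b hab N x h hmesh hsize _ hh u hu hua hub Pb hPb p hp M hM
  obtain ⟨hN, hxa, hxb, hx⟩ := id hmesh
  have hlt : a < b := by linarith
  have hM' : ∀ j ≤ 2 * k, ∀ y ∈ Set.Icc a b, |iteratedDeriv j u y| ≤ M := fun j hj =>
    abs_le_on_Icc_of_abs_le_on_Ioo (hu.continuous_iteratedDeriv j (by exact_mod_cast hj)) hlt
      (hM j hj)
  have hM0 : 0 ≤ M := (abs_nonneg _).trans (hM' 0 (Nat.zero_le _) a ⟨le_rfl, hlt.le⟩)
  have hh0 : 0 ≤ h := by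
    have h1 := hsize.1 1 (by simpa using hN)
    have h2 := hx 0 (by omega)
    simp only [Nat.sub_self, zero_add] at h1 h2
    linarith
  have hbound := hstab a b hab N x h (K * (h ^ k * M)) hmesh hsize.1
    (hh.trans (min_le_left _ _)) (by positivity) (fun i => Pb i - p i)
    (isVh0_sub_elemProj hN (by rw [hxa, hua]) (by rw [hxb, hub]) hPb.1 hp) (by
      intro i hi s hs hleg
      obtain ⟨h1i, hiN⟩ := Finset.mem_Icc.1 hi
      have hlr : x (i - 1) < x i := by
        simpa [Nat.sub_add_cancel h1i] using hx (i - 1) (by omega)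
      refine le_of_eq_of_le (congrArg abs ?_)
        (hcons u _ _ h M (p i) hu hlr (hsize.1 i hi) (hh.trans (min_le_right _ _)) hM0 (hp i hi)
          (fun j hj y hy => hM' j hj y ⟨?_, ?_⟩) s (Set.Ioo_subset_Icc_self hs) hleg)
      · have := hPb.2 i hi s hs hleg
        simp only [Polynomial.derivative_sub, Polynomial.eval_sub]
        linear_combination this
      · rw [← hxa]
        exact (mesh_le hx (i - 1) (by omega) 0 (by omega)).trans hy.1
      · rw [← hxb]
        exact hy.2.trans (mesh_le hx N le_rfl i hiN))
  refine (sqrt_sum_integral_le (by positivity) hx hbound).trans (le_of_eq ?_)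
  rw [hxa, hxb, hab]
  ring
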